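/- The group G presented by the six generators c_{1,1}, c_{2,1}, c_{1,2}, c_{3,1}, c_{2,2}, c_{1,3} subject to the relations (for ε = ±1): c_{2,1}^{c_{1,1}^ε} = c_{2,1}; c_{1,2}^{c_{1,1}^ε} = c_{1,2}^{c_{2,1}^{−ε}}; c_{3,1}^{c_{1,1}^ε} = c_{3,1}; c_{2,2}^{c_{1,1}^ε} = c_{2,2}; c_{1,3}^{c_{1,1}^ε} = c_{1,3}^{c_{2,2}^{−ε}}; c_{3,1}^{c_{2,1}^ε} = c_{3,1}; c_{2,2}^{c_{2,1}^ε} = c_{2,2}^{c_{3,1}^{−ε}}; c_{1,3}^{c_{2,1}^ε} = c_{1,3}^{c_{2,2}^{ε} c_{3,1}^{−ε}}; c_{3,1}^{c_{1,2}^ε} = c_{3,1}; c_{1,3}^{c_{1,2}^ε} = c_{1,3}^{c_{3,1}^{−ε}}; c_{2,2}^{c_{1,2}^{−1}} = c_{1,3}^{c_{3,1}} · (c_{1,3}^{−1})^{c_{2,2}} · c_{2,2} · [c_{2,1}^2, c_{1,2}^{−1}]; and c_{2,2}^{c_{1,2}} = [c_{1,2}, c_{2,1}^{−2}] · (c_{1,3}^{−1})^{c_{2,2}^{−2}}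 · c_{2,2} · c_{1,3}^{c_{3,1}^{−1}}, is isomorphic to the Artin pure braid group P_4. -/

import Mathlib

/-- The six cabled generators `c_{1,1}, c_{2,1}, c_{1,2}, c_{3,1}, c_{2,2}, c_{1,3}`. -/
inductive CGen : Type
  | c11 | c21 | c12 | c31 | c22 | c13
  deriving DecidableEq

open CGen

/-- The generators of the free group on `CGen`. -/
def g : CGen → FreeGroup CGen := FreeGroup.of

/-- Conjugation `a^b = b⁻¹ a b`. -/
def cjC (a b : FreeGroup CGen) : FreeGroup CGen := b⁻¹ * a * b

/-- The commutator `[a,b] = a⁻¹ b⁻¹ a b`. -/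
def cmC (a b : FreeGroup CGen) : FreeGroup CGen := a⁻¹ * b⁻¹ * a * b

/-- The defining relators of `P_4` in the cabled generators (a relation `u = v`
contributes the relator `u * v⁻¹`; `ε = ±1`). -/
def Grels : Set (FreeGroup CGen) :=
  {w |
    (∃ ε : ℤ, (ε = 1 ∨ ε = -1) ∧
      (w = cjC (g c21) ((g c11) ^ ε) * (g c21)⁻¹ ∨
       w = cjC (g c12) ((g c11) ^ ε) * (cjC (g c12) ((g c21) ^ (-ε)))⁻¹ ∨
       w = cjC (g c31) ((g c11) ^ ε) * (g c31)⁻¹ ∨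
       w = cjC (g c22) ((g c11) ^ ε) * (g c22)⁻¹ ∨
       w = cjC (g c13) ((g c11) ^ ε) * (cjC (g c13) ((g c22) ^ (-ε)))⁻¹ ∨
       w = cjC (g c31) ((g c21) ^ ε) * (g c31)⁻¹ ∨
       w = cjC (g c22) ((g c21) ^ ε) * (cjC (g c22) ((g c31) ^ (-ε)))⁻¹ ∨
       w = cjC (g c13) ((g c21) ^ ε) * (cjC (g c13) ((g c22) ^ ε * (g c31) ^ (-ε)))⁻¹ ∨
       w = cjC (g c31) ((g c12) ^ ε) * (g c31)⁻¹ ∨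
       w = cjC (g c13) ((g c12) ^ ε) * (cjC (g c13) ((g c31) ^ (-ε)))⁻¹)) ∨
    w = cjC (g c22) ((g c12)⁻¹) *
          (cjC (g c13) (g c31) * cjC ((g c13)⁻¹) (g c22) * g c22 *
            cmC ((g c21) ^ (2 : ℕ)) ((g c12)⁻¹))⁻¹ ∨
    w = cjC (g c22) (g c12) *
          (cmC (g c12) ((g c21) ^ (-2 : ℤ)) * cjC ((g c13)⁻¹) ((g c22) ^ (-2 : ℤ)) *
            g c22 * cjC (g c13) ((g c31)⁻¹))⁻¹}

/-- Generator indices `(i,j)` with `1 ≤ i < j ≤ 4` for the Artin generators `A_{i,j}` of `P_4`. -/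
def PGen : Type := {p : ℕ × ℕ // 1 ≤ p.1 ∧ p.1 < p.2 ∧ p.2 ≤ 4}

/-- The Artin generator `A_{i,j}` of the free group on `PGen` (junk value `1` out of range). -/
def AA (i j : ℕ) : FreeGroup PGen :=
  if h : 1 ≤ i ∧ i < j ∧ j ≤ 4 then FreeGroup.of ⟨(i, j), h⟩ else 1

/-- The commutator `[a,b] = a⁻¹ b⁻¹ a b`. -/
def cmP (a b : FreeGroup PGen) : FreeGroup PGen := a⁻¹ * b⁻¹ * a * b

/-- The standard Burau–Artin defining relators of the pure braid group `P_4` (`ε = ±1`). -/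
def P4rels : Set (FreeGroup PGen) :=
  {w | ∃ ε : ℤ, (ε = 1 ∨ ε = -1) ∧
    ((∃ i k j : ℕ, 1 ≤ i ∧ i < k ∧ k < j ∧ j ≤ 4 ∧
        w = (AA i k) ^ (-ε) * AA k j * (AA i k) ^ ε *
          ((AA i j * AA k j) ^ ε * AA k j * (AA i j * AA k j) ^ (-ε))⁻¹) ∨
     (∃ k m j : ℕ, 1 ≤ k ∧ k < m ∧ m < j ∧ j ≤ 4 ∧
        w = (AA k m) ^ (-ε) * AA k j * (AA k m) ^ ε *
          ((AA k j * AA m j) ^ ε * AA k j * (AA k j * AA m j) ^ (-ε))⁻¹) ∨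
     (∃ i k m j : ℕ, 1 ≤ i ∧ i < k ∧ k < m ∧ m < j ∧ j ≤ 4 ∧
        w = (AA i m) ^ (-ε) * AA k j * (AA i m) ^ ε *
          ((cmP ((AA i j) ^ (-ε)) ((AA m j) ^ (-ε))) ^ ε * AA k j *
            (cmP ((AA i j) ^ (-ε)) ((AA m j) ^ (-ε))) ^ (-ε))⁻¹) ∨
     (∃ i m k j : ℕ, 1 ≤ i ∧ i < m ∧ m ≤ 4 ∧ 1 ≤ k ∧ k < j ∧ j ≤ 4 ∧
        ((k < i ∧ m < j) ∨ m < k) ∧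
        w = (AA i m) ^ (-ε) * AA k j * (AA i m) ^ ε * (AA k j)⁻¹))}

set_option linter.unusedSimpArgs false

/-- The commutation relations among full twists on disjoint or nested intervals of strands:
`z, y, w` on `12`, `23`, `34`, `T, U` on `123`, `234`, and `D` on all four strands. -/
structure TwistCommute {H : Type*} [Group H] (z y w T U D : H) : Prop where
  Dz : Commute D z
  Dy : Commute D y
  Dw : Commute D w
  DT : Commute D T
  DU : Commute D U
  Tz : Commute T z
  Ty : Commute T y
  zw : Commute z w
  Uw : Commute U w
  Uy : Commute U y

/-- Six elements of a group subject to the relations satisfied in `P_4` by the full twists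
`z, y, w` on the strands `12`, `23`, `34`, `T, U` on `123`, `234`, and `D` on all four strands. -/
structure IsTwistSystem {H : Type*} [Group H] (z y w T U D : H) : Prop
    extends TwistCommute z y w T U D where
  pentagon : T * U * y⁻¹ * (z * w⁻¹) = z * w⁻¹ * U * T * y⁻¹

/-- The images of the cabled generators in terms of a twist system. -/
def cabledWord {H : Type*} [Group H] (z y w T U D : H) : CGen → H
  | .c11 => z
  | .c21 => z⁻¹ * T
  | .c12 => T * y⁻¹
  | .c31 => T⁻¹ * D
  | .c22 => z⁻¹ * D * w⁻¹
  | .c13 => U⁻¹ * D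

/-- The images of the Artin generators in terms of a twist system. -/
def artinWord {H : Type*} [Group H] (z y w T U D : H) : ℕ → ℕ → H
  | 1, 2 => z
  | 2, 3 => y
  | 3, 4 => w
  | 1, 3 => z⁻¹ * T * y⁻¹
  | 2, 4 => y⁻¹ * U * w⁻¹
  | 1, 4 => T⁻¹ * D * U⁻¹ * y
  | _, _ => 1

section Conjugation

variable {H : Type*} [Group H] {a b c x : H}

theorem conj_eq_conj_iff : a⁻¹ * b * a = x⁻¹ * b * x ↔ Commute (a * x⁻¹) b := by
  rw [commute_iff_eq]
  constructor
  · intro h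
    calc a * x⁻¹ * b = a * (x⁻¹ * b * x) * x⁻¹ := by group
      _ = _ := by rw [← h]; group
  · intro h
    calc a⁻¹ * b * a = a⁻¹ * (b * (a * x⁻¹)) * x := by group
      _ = _ := by rw [← h]; group

theorem conj_zpow_eq_self (h : Commute a b) (ε : ℤ) : (a ^ ε)⁻¹ * b * a ^ ε = b := by
  rw [mul_assoc, ← (h.zpow_left ε).eq, inv_mul_cancel_left]

theorem conj_zpow_eq_conj_zpow_neg (h : Commute a x) (h' : Commute (a * x) b) (ε : ℤ) :
    (a ^ ε)⁻¹ * b * a ^ ε = (x ^ (-ε))⁻¹ * b * x ^ (-ε) := by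
  rw [conj_eq_conj_iff, zpow_neg, inv_inv, ← h.mul_zpow]
  exact h'.zpow_left ε

theorem conj_last_of_commute (h : Commute (a * b) c) (h' : Commute a (b * c))
    {ε : ℤ} (hε : ε = 1 ∨ ε = -1) :
    a ^ (-ε) * c * a ^ ε = (b * c) ^ ε * c * (b * c) ^ (-ε) := by
  have key := (conj_eq_conj_iff (a := a ^ ε) (b := c) (x := (b * c) ^ (-ε))).2 ?_
  · simpa using key
  rcases hε with rfl | rfl
  · simpa [mul_assoc] using h.mul_left (Commute.refl c)
  · have e : a⁻¹ * (b * c)⁻¹ = (a * b * c)⁻¹ := by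
      rw [mul_assoc, ← mul_inv_rev, h'.eq]
    simpa [e, -mul_inv_rev] using (h.mul_left (Commute.refl c)).inv_left

theorem conj_middle_of_commute (h : Commute (a * b) c) (h' : Commute a (b * c))
    {ε : ℤ} (hε : ε = 1 ∨ ε = -1) :
    a ^ (-ε) * b * a ^ ε = (b * c) ^ ε * b * (b * c) ^ (-ε) := by
  have h1 := conj_last_of_commute h h' hε
  have h2 : a ^ (-ε) * (b * c) * a ^ ε = b * c := by
    rw [(h'.zpow_left (-ε)).eq]; group
  have h3 : a ^ (-ε) * b * a ^ ε =
      (a ^ (-ε) * (b * c) * a ^ ε) * (a ^ (-ε) * c * a ^ ε)⁻¹ := by group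
  rw [h3, h2, h1]
  rcases hε with rfl | rfl <;> group

theorem commute_of_conj (h1 : a⁻¹ * c * a = b * c * b⁻¹)
    (h2 : a⁻¹ * b * a = b * c * b * (b * c)⁻¹) :
    Commute (a * b) c ∧ Commute a (b * c) := by
  constructor
  · have : c * a * b = a * b * c := by
      calc c * a * b = a * (a⁻¹ * c * a) * b := by group
        _ = _ := by rw [h1]; group
    rw [commute_iff_eq, ← this, mul_assoc]
  · have : a⁻¹ * (b * c) * a = b * c := by
      calc a⁻¹ * (b * c) * a = (a⁻¹ * b * a) * (a⁻¹ * c * a) := by group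
        _ = _ := by rw [h1, h2]; group
    rw [commute_iff_eq]
    calc a * (b * c) = a * (a⁻¹ * (b * c) * a) := by rw [this]
      _ = _ := by group

theorem commute_conj_left_iff : Commute (a * b * a⁻¹) c ↔ Commute b (a⁻¹ * c * a) := by
  simp only [commute_iff_eq]
  constructor
  · intro h
    calc b * (a⁻¹ * c * a) = a⁻¹ * (a * b * a⁻¹ * c) * a := by group
      _ = _ := by rw [h]; group
  · intro h
    calc a * b * a⁻¹ * c = a * (b * (a⁻¹ * c * a)) * a⁻¹ := by group
      _ = _ := by rw [h]; group

theorem mul_commutator_of_commute (h : Commute (a * b) c) :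
    a * (b * c * b⁻¹ * c⁻¹) = c * a * c⁻¹ := by
  calc a * (b * c * b⁻¹ * c⁻¹) = a * b * c * (b⁻¹ * c⁻¹) := by group
    _ = c * (a * b) * (b⁻¹ * c⁻¹) := by rw [h.eq]
    _ = _ := by group

theorem inv_mul_commutator_of_commute (h : Commute (a * b) c) (h' : Commute a (b * c)) :
    a⁻¹ * (c⁻¹ * b⁻¹ * c * b) = (c * a * c⁻¹)⁻¹ := by
  rw [eq_inv_iff_mul_eq_one]
  calc a⁻¹ * (c⁻¹ * b⁻¹ * c * b) * (c * a * c⁻¹)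
      = a⁻¹ * c⁻¹ * b⁻¹ * c * (b * c * a) * c⁻¹ := by group
    _ = a⁻¹ * c⁻¹ * b⁻¹ * c * (a * b * c) * c⁻¹ := by rw [← h'.eq, mul_assoc a b c]
    _ = a⁻¹ * (b * c)⁻¹ * (c * (a * b)) := by group
    _ = a⁻¹ * (b * c)⁻¹ * (a * (b * c)) := by rw [← h.eq, mul_assoc a b c]
    _ = 1 := by rw [h'.eq]; group

theorem conj_crossing_of_commute (h : Commute (a * b) c) (h' : Commute a (b * c))
    (hx : Commute (c * a * c⁻¹) x) {ε : ℤ} (hε : ε = 1 ∨ ε = -1) :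
    a ^ (-ε) * x * a ^ ε =
      ((b ^ (-ε))⁻¹ * (c ^ (-ε))⁻¹ * b ^ (-ε) * c ^ (-ε)) ^ ε * x *
        ((b ^ (-ε))⁻¹ * (c ^ (-ε))⁻¹ * b ^ (-ε) * c ^ (-ε)) ^ (-ε) := by
  have key := (conj_eq_conj_iff (a := a ^ ε) (b := x)
    (x := ((b ^ (-ε))⁻¹ * (c ^ (-ε))⁻¹ * b ^ (-ε) * c ^ (-ε)) ^ (-ε))).2 ?_
  · simpa only [zpow_neg, inv_inv] using key
  rcases hε with rfl | rfl
  · have := mul_commutator_of_commute h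
    simp only [zpow_neg, zpow_one, inv_inv]
    rwa [this]
  · have := inv_mul_commutator_of_commute h h'
    simp only [zpow_neg, zpow_one, inv_inv, mul_inv_rev] at this ⊢
    simp only [← mul_assoc] at this ⊢
    rw [this]
    simpa [mul_assoc] using hx.inv_left

/-- The ways of moving `a^{±1}` to the left of `b^{±1}`, for rewriting. -/
theorem Commute.swaps (h : Commute a b) :
    (b * a = a * b ∧ b⁻¹ * a = a * b⁻¹ ∧ b * a⁻¹ = a⁻¹ * b ∧ b⁻¹ * a⁻¹ = a⁻¹ * b⁻¹) ∧
    (∀ c, b * (a * c) = a * (b * c)) ∧ (∀ c, b⁻¹ * (a * c) = a * (b⁻¹ * c)) ∧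
    (∀ c, b * (a⁻¹ * c) = a⁻¹ * (b * c)) ∧ (∀ c, b⁻¹ * (a⁻¹ * c) = a⁻¹ * (b⁻¹ * c)) :=
  ⟨⟨h.symm.eq, h.symm.inv_left.eq, h.symm.inv_right.eq, h.symm.inv_inv.eq⟩,
    h.symm.left_comm, h.symm.inv_left.left_comm, h.symm.inv_right.left_comm,
    h.symm.inv_inv.left_comm⟩

end Conjugation

section Pentagon

variable {H : Type*} [Group H] {z y w T U D : H}

theorem c22_conj_inv_iff_pentagon (h : TwistCommute z y w T U D) :
    T * y⁻¹ * (z⁻¹ * D * w⁻¹) * (T * y⁻¹)⁻¹ =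
      (T⁻¹ * D)⁻¹ * (U⁻¹ * D) * (T⁻¹ * D) *
        ((z⁻¹ * D * w⁻¹)⁻¹ * (U⁻¹ * D)⁻¹ * (z⁻¹ * D * w⁻¹)) * (z⁻¹ * D * w⁻¹) *
        ((z⁻¹ * T * (z⁻¹ * T))⁻¹ * (T * y⁻¹) * (z⁻¹ * T * (z⁻¹ * T)) * (T * y⁻¹)⁻¹) ↔
    T * U * y⁻¹ * (z * w⁻¹) = z * w⁻¹ * U * T * y⁻¹ := by
  have e1 : T * y⁻¹ * (z⁻¹ * D * w⁻¹) * (T * y⁻¹)⁻¹ =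
      D * T * U⁻¹ * T⁻¹ * (T * U * y⁻¹ * (z * w⁻¹)) * (z⁻¹ * z⁻¹ * y * T⁻¹) := by
    simp only [mul_assoc, mul_inv_rev, inv_inv, mul_inv_cancel_left, inv_mul_cancel_left,
      mul_inv_cancel, inv_mul_cancel, mul_one, h.Dz.swaps, h.Dy.swaps, h.Dw.swaps, h.DT.swaps,
      h.DU.swaps, h.Tz.symm.swaps, h.Ty.symm.swaps, h.zw.swaps, h.Uw.symm.swaps, h.Uy.symm.swaps]
  have e2 : (T⁻¹ * D)⁻¹ * (U⁻¹ * D) * (T⁻¹ * D) *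
        ((z⁻¹ * D * w⁻¹)⁻¹ * (U⁻¹ * D)⁻¹ * (z⁻¹ * D * w⁻¹)) * (z⁻¹ * D * w⁻¹) *
        ((z⁻¹ * T * (z⁻¹ * T))⁻¹ * (T * y⁻¹) * (z⁻¹ * T * (z⁻¹ * T)) * (T * y⁻¹)⁻¹) =
      D * T * U⁻¹ * T⁻¹ * (z * w⁻¹ * U * T * y⁻¹) * (z⁻¹ * z⁻¹ * y * T⁻¹) := by
    simp only [mul_assoc, mul_inv_rev, inv_inv, mul_inv_cancel_left, inv_mul_cancel_left,
      mul_inv_cancel, inv_mul_cancel, mul_one, h.Dz.swaps, h.Dy.swaps, h.Dw.swaps, h.DT.swaps,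
      h.DU.swaps, h.Tz.symm.swaps, h.Ty.symm.swaps, h.zw.swaps, h.Uw.symm.swaps, h.Uy.symm.swaps]
  rw [e1, e2, mul_left_inj, mul_right_inj]

theorem c22_conj_iff_pentagon (h : TwistCommute z y w T U D) :
    (T * y⁻¹)⁻¹ * (z⁻¹ * D * w⁻¹) * (T * y⁻¹) =
      (T * y⁻¹)⁻¹ * (z⁻¹ * T * (z⁻¹ * T)) * (T * y⁻¹) * (z⁻¹ * T * (z⁻¹ * T))⁻¹ *
        (z⁻¹ * D * w⁻¹ * (z⁻¹ * D * w⁻¹) * (U⁻¹ * D)⁻¹ *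
          (z⁻¹ * D * w⁻¹ * (z⁻¹ * D * w⁻¹))⁻¹) * (z⁻¹ * D * w⁻¹) *
        (T⁻¹ * D * (U⁻¹ * D) * (T⁻¹ * D)⁻¹) ↔
    T * U * y⁻¹ * (z * w⁻¹) = z * w⁻¹ * U * T * y⁻¹ := by
  have e1 : (T * y⁻¹)⁻¹ * (z⁻¹ * D * w⁻¹) * (T * y⁻¹) =
      D * y * z⁻¹ * z⁻¹ * T⁻¹ * (z * w⁻¹ * U * T * y⁻¹) * (T⁻¹ * U⁻¹ * T) := by
    simp only [mul_assoc, mul_inv_rev, inv_inv, mul_inv_cancel_left, inv_mul_cancel_left,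
      mul_inv_cancel, inv_mul_cancel, mul_one, h.Dz.swaps, h.Dy.swaps, h.Dw.swaps, h.DT.swaps,
      h.DU.swaps, h.Tz.symm.swaps, h.Ty.symm.swaps, h.zw.swaps, h.Uw.symm.swaps, h.Uy.symm.swaps]
  have e2 : (T * y⁻¹)⁻¹ * (z⁻¹ * T * (z⁻¹ * T)) * (T * y⁻¹) * (z⁻¹ * T * (z⁻¹ * T))⁻¹ *
        (z⁻¹ * D * w⁻¹ * (z⁻¹ * D * w⁻¹) * (U⁻¹ * D)⁻¹ *
          (z⁻¹ * D * w⁻¹ * (z⁻¹ * D * w⁻¹))⁻¹) * (z⁻¹ * D * w⁻¹) *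
        (T⁻¹ * D * (U⁻¹ * D) * (T⁻¹ * D)⁻¹) =
      D * y * z⁻¹ * z⁻¹ * T⁻¹ * (T * U * y⁻¹ * (z * w⁻¹)) * (T⁻¹ * U⁻¹ * T) := by
    simp only [mul_assoc, mul_inv_rev, inv_inv, mul_inv_cancel_left, inv_mul_cancel_left,
      mul_inv_cancel, inv_mul_cancel, mul_one, h.Dz.swaps, h.Dy.swaps, h.Dw.swaps, h.DT.swaps,
      h.DU.swaps, h.Tz.symm.swaps, h.Ty.symm.swaps, h.zw.swaps, h.Uw.swaps, h.Uy.symm.swaps]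
  rw [e1, e2, mul_left_inj, mul_right_inj, eq_comm]

theorem triple124_iff_pentagon (h : TwistCommute z y w T U D) :
    Commute (z * (T⁻¹ * D * U⁻¹ * y)) (y⁻¹ * U * w⁻¹) ↔
      T * U * y⁻¹ * (z * w⁻¹) = z * w⁻¹ * U * T * y⁻¹ := by
  have e1 : z * (T⁻¹ * D * U⁻¹ * y) * (y⁻¹ * U * w⁻¹) =
      D * T⁻¹ * (z * w⁻¹ * U * T * y⁻¹) * (T⁻¹ * U⁻¹ * y) := by
    simp only [mul_assoc, mul_inv_rev, inv_inv, mul_inv_cancel_left, inv_mul_cancel_left,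
        mul_inv_cancel, inv_mul_cancel, mul_one, h.Dz.swaps, h.Dy.swaps, h.Dw.swaps, h.DT.swaps,
        h.DU.swaps, h.Tz.symm.swaps, h.Ty.symm.swaps, h.zw.swaps, h.Uw.symm.swaps, h.Uy.symm.swaps]
  have e2 : y⁻¹ * U * w⁻¹ * (z * (T⁻¹ * D * U⁻¹ * y)) =
      D * T⁻¹ * (T * U * y⁻¹ * (z * w⁻¹)) * (T⁻¹ * U⁻¹ * y) := by
    simp only [mul_assoc, mul_inv_rev, inv_inv, mul_inv_cancel_left, inv_mul_cancel_left,
        mul_inv_cancel, inv_mul_cancel, mul_one, h.Dz.swaps, h.Dy.swaps, h.Dw.swaps, h.DT.swaps,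
        h.DU.swaps, h.Tz.symm.swaps, h.Ty.symm.swaps, h.zw.swaps, h.Uw.swaps, h.Uy.symm.swaps]
  rw [commute_iff_eq, e1, e2, mul_left_inj, mul_right_inj, eq_comm]

end Pentagon

namespace IsTwistSystem

variable {H : Type*} [Group H] {z y w T U D : H}

theorem triple123 (h : IsTwistSystem z y w T U D) :
    Commute (z * (z⁻¹ * T * y⁻¹)) y ∧ Commute z (z⁻¹ * T * y⁻¹ * y) := by
  constructor
  · simpa [mul_assoc] using h.Ty.mul_left (Commute.refl y).inv_left
  · simpa using (Commute.refl z).inv_right.mul_right h.Tz.symm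

theorem triple234 (h : IsTwistSystem z y w T U D) :
    Commute (y * (y⁻¹ * U * w⁻¹)) w ∧ Commute y (y⁻¹ * U * w⁻¹ * w) := by
  constructor
  · simpa [mul_assoc] using h.Uw.mul_left (Commute.refl w).inv_left
  · simpa using (Commute.refl y).inv_right.mul_right h.Uy.symm

theorem triple124 (h : IsTwistSystem z y w T U D) :
    Commute (z * (T⁻¹ * D * U⁻¹ * y)) (y⁻¹ * U * w⁻¹) ∧
      Commute z (T⁻¹ * D * U⁻¹ * y * (y⁻¹ * U * w⁻¹)) := by
  refine ⟨(triple124_iff_pentagon h.toTwistCommute).2 h.pentagon, ?_⟩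
  simpa [mul_assoc] using h.Tz.symm.inv_right.mul_right
      (h.Dz.symm.mul_right h.zw.inv_right)

theorem triple134 (h : IsTwistSystem z y w T U D) :
    Commute (z⁻¹ * T * y⁻¹ * (T⁻¹ * D * U⁻¹ * y)) w ∧
      Commute (z⁻¹ * T * y⁻¹) (T⁻¹ * D * U⁻¹ * y * w) := by
  constructor
  · have e : z⁻¹ * T * y⁻¹ * (T⁻¹ * D * U⁻¹ * y) = z⁻¹ * D * U⁻¹ := by
      simp only [mul_assoc, mul_inv_rev, inv_inv, mul_inv_cancel_left, inv_mul_cancel_left,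
        mul_inv_cancel, inv_mul_cancel, mul_one, h.Dz.swaps, h.Dy.swaps, h.Dw.swaps, h.DT.swaps,
        h.DU.swaps, h.Tz.symm.swaps, h.Ty.symm.swaps, h.zw.swaps, h.Uw.symm.swaps, h.Uy.symm.swaps]
    rw [e]
    exact (h.zw.inv_left.mul_left h.Dw).mul_left h.Uw.inv_left
  · rw [commute_iff_eq]
    have e1 : z⁻¹ * T * y⁻¹ * (T⁻¹ * D * U⁻¹ * y * w) =
        D * (T * U * y⁻¹ * (z * w⁻¹))⁻¹ * (T * y⁻¹) := by
      simp only [mul_assoc, mul_inv_rev, inv_inv, mul_inv_cancel_left, inv_mul_cancel_left,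
        mul_inv_cancel, inv_mul_cancel, mul_one, h.Dz.swaps, h.Dy.swaps, h.Dw.swaps, h.DT.swaps,
        h.DU.swaps, h.Tz.symm.swaps, h.Ty.symm.swaps, h.zw.swaps, h.Uw.symm.swaps, h.Uy.symm.swaps]
    rw [e1, h.pentagon]
    simp only [mul_assoc, mul_inv_rev, inv_inv, mul_inv_cancel_left, inv_mul_cancel_left,
      mul_inv_cancel, inv_mul_cancel, mul_one, h.Dz.swaps, h.Dy.swaps, h.Dw.swaps, h.DT.swaps,
      h.DU.swaps, h.Tz.symm.swaps, h.Ty.symm.swaps, h.zw.swaps, h.Uw.symm.swaps, h.Uy.symm.swaps]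

theorem commute14_23 (h : IsTwistSystem z y w T U D) : Commute (T⁻¹ * D * U⁻¹ * y) y :=
  ((h.Ty.inv_left.mul_left h.Dy).mul_left h.Uy.inv_left).mul_left (Commute.refl y)

theorem crossing (h : IsTwistSystem z y w T U D) :
    Commute (w * (z⁻¹ * T * y⁻¹) * w⁻¹) (y⁻¹ * U * w⁻¹) := by
  rw [commute_conj_left_iff]
  have e : w⁻¹ * (y⁻¹ * U * w⁻¹) * w = z⁻¹ * T * y⁻¹ * U * (z * w⁻¹ * T⁻¹) := by
    have : z⁻¹ * T * y⁻¹ * U * (z * w⁻¹ * T⁻¹) =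
        z⁻¹ * (T * U * y⁻¹ * (z * w⁻¹)) * T⁻¹ := by
      simp only [mul_assoc, h.Uy.symm.swaps]
    rw [this, h.pentagon]
    simp only [mul_assoc, mul_inv_rev, inv_inv, mul_inv_cancel_left, inv_mul_cancel_left,
      mul_inv_cancel, inv_mul_cancel, mul_one, h.Dz.swaps, h.Dy.swaps, h.Dw.swaps, h.DT.swaps,
      h.DU.swaps, h.Tz.symm.swaps, h.Ty.symm.swaps, h.zw.swaps, h.Uw.symm.swaps, h.Uy.symm.swaps]
  rw [commute_iff_eq]
  conv_rhs => rw [e]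
  simp only [mul_assoc, mul_inv_rev, inv_inv, mul_inv_cancel_left, inv_mul_cancel_left,
    mul_inv_cancel, inv_mul_cancel, mul_one, h.Dz.swaps, h.Dy.swaps, h.Dw.swaps, h.DT.swaps,
    h.DU.swaps, h.Tz.symm.swaps, h.Ty.symm.swaps, h.zw.swaps, h.Uw.symm.swaps, h.Uy.symm.swaps]

theorem lift_cabledWord_eq_one (h : IsTwistSystem z y w T U D) :
    ∀ r ∈ Grels, FreeGroup.lift (cabledWord z y w T U D) r = 1 := by
  have c21z : Commute (z⁻¹ * T) z := (Commute.refl z).inv_left.mul_left h.Tz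
  have c31z : Commute (T⁻¹ * D) z := h.Tz.inv_left.mul_left h.Dz
  have c31T : Commute (T⁻¹ * D) T := (Commute.refl T).inv_left.mul_left h.DT
  have c31y : Commute (T⁻¹ * D) y := h.Ty.inv_left.mul_left h.Dy
  have c22z : Commute (z⁻¹ * D * w⁻¹) z :=
    ((Commute.refl z).inv_left.mul_left h.Dz).mul_left h.zw.symm.inv_left
  have c31c21 : Commute (T⁻¹ * D) (z⁻¹ * T) := c31z.inv_right.mul_right c31T
  have c31c12 : Commute (T⁻¹ * D) (T * y⁻¹) := c31T.mul_right c31y.inv_right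
  have hD : Commute D (U⁻¹ * D) := h.DU.inv_right.mul_right (Commute.refl D)
  have hw : Commute w (U⁻¹ * D) := h.Uw.symm.inv_right.mul_right h.Dw.symm
  have hy : Commute y (U⁻¹ * D) := h.Uy.symm.inv_right.mul_right h.Dy.symm
  rintro r (⟨ε, hε, hr⟩ | rfl | rfl)
  · rcases hr with rfl | rfl | rfl | rfl | rfl | rfl | rfl | rfl | rfl | rfl
    all_goals
      simp only [cjC, g, map_mul, map_inv, map_zpow, FreeGroup.lift_apply_of, mul_inv_eq_one,
        cabledWord]
    · exact conj_zpow_eq_self c21z.symm ε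
    · refine conj_zpow_eq_conj_zpow_neg c21z.symm ?_ ε
      rw [mul_inv_cancel_left]
      exact (Commute.refl T).mul_right h.Ty.inv_right
    · exact conj_zpow_eq_self c31z.symm ε
    · exact conj_zpow_eq_self c22z.symm ε
    · refine conj_zpow_eq_conj_zpow_neg c22z.symm ?_ ε
      rw [mul_assoc z⁻¹, mul_inv_cancel_left]
      exact hD.mul_left hw.inv_left
    · exact conj_zpow_eq_self c31c21.symm ε
    · refine conj_zpow_eq_conj_zpow_neg c31c21.symm ?_ ε
      rw [mul_assoc z⁻¹ T, mul_inv_cancel_left]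
      exact (Commute.refl (z⁻¹ * D)).mul_right
        (h.zw.inv_inv.mul_left h.Dw.inv_right)
    · rw [conj_eq_conj_iff]
      have e : (z⁻¹ * T) ^ ε * ((z⁻¹ * D * w⁻¹) ^ ε * (T⁻¹ * D) ^ (-ε))⁻¹ = w ^ ε := by
        rcases hε with rfl | rfl
        · simp [mul_assoc, h.Dw.swaps, h.zw.swaps]
        · simp [mul_assoc, h.Dz.swaps, h.DT.swaps, h.Tz.symm.swaps]
      rw [e]
      exact hw.zpow_left ε
    · exact conj_zpow_eq_self c31c12.symm ε
    · refine conj_zpow_eq_conj_zpow_neg c31c12.symm ?_ ε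
      rw [← c31c12.eq]
      have e : T⁻¹ * D * (T * y⁻¹) = D * y⁻¹ := by
        rw [h.DT.inv_right.symm.eq, mul_assoc, inv_mul_cancel_left]
      rw [e]
      exact hD.mul_left hy.inv_left
  · simp only [cjC, cmC, g, map_mul, map_inv, map_pow, FreeGroup.lift_apply_of, mul_inv_eq_one,
      cabledWord, pow_two, inv_inv]
    have := (c22_conj_inv_iff_pentagon h.toTwistCommute).2 h.pentagon
    simpa only [mul_assoc, mul_inv_rev, inv_inv] using this
  · simp only [cjC, cmC, g, map_mul, map_inv, map_zpow, FreeGroup.lift_apply_of, mul_inv_eq_one,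
      cabledWord, zpow_neg, zpow_ofNat, pow_two, inv_inv]
    have := (c22_conj_iff_pentagon h.toTwistCommute).2 h.pentagon
    simpa only [mul_assoc, mul_inv_rev, inv_inv] using this

end IsTwistSystem

section Lift

variable {H : Type*} [Group H]

theorem lift_AA (F : ℕ → ℕ → H) {i j : ℕ} (hi : 1 ≤ i) (hij : i < j) (hj : j ≤ 4) :
    FreeGroup.lift (fun p : PGen => F p.1.1 p.1.2) (AA i j) = F i j := by
  rw [AA, dif_pos ⟨hi, hij, hj⟩]
  exact FreeGroup.lift_apply_of

namespace IsTwistSystem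

variable {z y w T U D : H}

theorem lift_artinWord_eq_one (h : IsTwistSystem z y w T U D) :
    ∀ r ∈ P4rels, FreeGroup.lift (fun p : PGen => artinWord z y w T U D p.1.1 p.1.2) r = 1 := by
  have triple : ∀ i k j : ℕ, 1 ≤ i → i < k → k < j → j ≤ 4 →
      Commute (artinWord z y w T U D i k * artinWord z y w T U D i j)
          (artinWord z y w T U D k j) ∧
        Commute (artinWord z y w T U D i k)
          (artinWord z y w T U D i j * artinWord z y w T U D k j) := by
    intro i k j h1 h2 h3 h4
    have : (i = 1 ∧ k = 2 ∧ j = 3) ∨ (i = 1 ∧ k = 2 ∧ j = 4) ∨ (i = 1 ∧ k = 3 ∧ j = 4) ∨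
        (i = 2 ∧ k = 3 ∧ j = 4) := by omega
    rcases this with ⟨rfl, rfl, rfl⟩ | ⟨rfl, rfl, rfl⟩ | ⟨rfl, rfl, rfl⟩ | ⟨rfl, rfl, rfl⟩
    exacts [h.triple123, h.triple124, h.triple134, h.triple234]
  rintro r ⟨ε, hε, ⟨i, k, j, h1, h2, h3, h4, rfl⟩ | ⟨k, m, j, h1, h2, h3, h4, rfl⟩ |
    ⟨i, k, m, j, h1, h2, h3, h4, h5, rfl⟩ | ⟨i, m, k, j, h1, h2, h3, h4, h5, h6, h7, rfl⟩⟩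
  · obtain ⟨t1, t2⟩ := triple i k j h1 h2 h3 h4
    simp only [map_mul, map_inv, map_zpow, mul_inv_eq_one]
    rw [lift_AA _ h1 h2 (by omega), lift_AA _ (by omega) h3 h4, lift_AA _ h1 (by omega) h4]
    exact conj_last_of_commute t1 t2 hε
  · obtain ⟨t1, t2⟩ := triple k m j h1 h2 h3 h4
    simp only [map_mul, map_inv, map_zpow, mul_inv_eq_one]
    rw [lift_AA _ h1 h2 (by omega), lift_AA _ (by omega) h3 h4, lift_AA _ h1 (by omega) h4]
    exact conj_middle_of_commute t1 t2 hε
  · obtain ⟨rfl, rfl, rfl, rfl⟩ : i = 1 ∧ k = 2 ∧ m = 3 ∧ j = 4 := by omega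
    simp only [cmP, map_mul, map_inv, map_zpow, mul_inv_eq_one]
    rw [lift_AA _ h1 (by omega) (by omega), lift_AA _ (by omega) (by omega) (by omega),
      lift_AA _ h1 (by omega) h5, lift_AA _ (by omega) (by omega) (by omega)]
    exact conj_crossing_of_commute h.triple134.1 h.triple134.2 h.crossing hε
  · simp only [map_mul, map_inv, map_zpow, mul_inv_eq_one]
    rw [lift_AA _ h1 h2 h3, lift_AA _ h4 h5 h6, zpow_neg]
    have : (i = 2 ∧ m = 3 ∧ k = 1 ∧ j = 4) ∨ (i = 1 ∧ m = 2 ∧ k = 3 ∧ j = 4) := by omega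
    rcases this with ⟨rfl, rfl, rfl, rfl⟩ | ⟨rfl, rfl, rfl, rfl⟩
    · exact conj_zpow_eq_self h.commute14_23.symm ε
    · exact conj_zpow_eq_self h.zw ε

theorem commute_three {a b c : H} (h : Commute (a * b) c) (h' : Commute a (b * c)) :
    Commute (a * b * c) a ∧ Commute (a * b * c) b ∧ Commute (a * b * c) c := by
  have h1 : Commute (a * b * c) a := by
    rw [mul_assoc]; exact (Commute.refl a).mul_left h'.symm
  have h3 : Commute (a * b * c) c := h.mul_left (Commute.refl c)
  refine ⟨h1, ?_, h3⟩
  have : b = a⁻¹ * (a * b * c) * c⁻¹ := by group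
  conv_rhs => rw [this]
  exact (h1.inv_right.mul_right (Commute.refl _)).mul_right h3.inv_right

theorem of_artin_commute {a12 a13 a23 a14 a24 a34 : H}
    (t123 : Commute (a12 * a13) a23) (t123' : Commute a12 (a13 * a23))
    (t124 : Commute (a12 * a14) a24) (t124' : Commute a12 (a14 * a24))
    (t134 : Commute (a13 * a14) a34) (t134' : Commute a13 (a14 * a34))
    (t234 : Commute (a23 * a24) a34) (t234' : Commute a23 (a24 * a34))
    (d12_34 : Commute a12 a34) (d23_14 : Commute a23 a14)
    (crossing : Commute (a34 * a13 * a34⁻¹) a24) :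
    IsTwistSystem a12 a23 a34 (a12 * a13 * a23) (a23 * a24 * a34)
      (a12 * a13 * a23 * a14 * a24 * a34) := by
  obtain ⟨T12, T13, T23⟩ := commute_three t123 t123'
  obtain ⟨U23, U24, U34⟩ := commute_three t234 t234'
  set D := a12 * a13 * a23 * a14 * a24 * a34 with hD
  have D_eq : D = a12 * (a13 * a14) * (a23 * a24 * a34) := by
    simp only [hD, mul_assoc, d23_14.left_comm]
  have D12 : Commute D a12 := by
    have : D = (a12 * a13 * a23) * (a14 * a24) * a34 := by simp only [hD, mul_assoc]
    rw [this]
    exact (T12.mul_left t124'.symm).mul_left d12_34.symm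
  have D23 : Commute D a23 := by
    have : D = (a12 * a13 * a23) * a14 * (a24 * a34) := by simp only [hD, mul_assoc]
    rw [this]
    exact (T23.mul_left d23_14.symm).mul_left t234'.symm
  have D34 : Commute D a34 := by
    rw [D_eq]
    exact (d12_34.mul_left t134).mul_left U34
  have D13 : Commute D a13 := by
    have : D = (a12 * a13 * a23) * (a14 * a34) * (a34⁻¹ * a24 * a34) := by
      rw [hD]; group
    rw [this]
    exact (T13.mul_left t134'.symm).mul_left (commute_conj_left_iff.1 crossing).symm
  have D24 : Commute D a24 := by
    have e : a34 * a13 * a34⁻¹ = a14⁻¹ * a13 * a14 := by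
      calc a34 * a13 * a34⁻¹ = a14⁻¹ * (a14 * a34 * a13) * a34⁻¹ := by group
        _ = a14⁻¹ * (a13 * (a14 * a34)) * a34⁻¹ := by rw [t134'.eq]
        _ = _ := by group
    have : D = a12 * a14 * (a14⁻¹ * a13 * a14) * (a23 * a24 * a34) := by
      rw [D_eq]; group
    rw [this, ← e]
    exact (t124.mul_left crossing).mul_left U24
  have h : TwistCommute a12 a23 a34 (a12 * a13 * a23) (a23 * a24 * a34) D :=
    { Dz := D12
      Dy := D23
      Dw := D34
      DT := (D12.mul_right D13).mul_right D23
      DU := (D23.mul_right D24).mul_right D34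
      Tz := T12
      Ty := T23
      zw := d12_34
      Uw := U34
      Uy := U23 }
  refine ⟨h, (triple124_iff_pentagon h).1 ?_⟩
  have e14 : (a12 * a13 * a23)⁻¹ * D * (a23 * a24 * a34)⁻¹ * a23 = a14 := by
    rw [hD]; group
  have e24 : a23⁻¹ * (a23 * a24 * a34) * a34⁻¹ = a24 := by group
  rwa [e14, e24]

theorem of_hom_killing_P4rels (f : FreeGroup PGen →* H) (hf : ∀ r ∈ P4rels, f r = 1) :
    IsTwistSystem (f (AA 1 2)) (f (AA 2 3)) (f (AA 3 4)) (f (AA 1 2) * f (AA 1 3) * f (AA 2 3))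
      (f (AA 2 3) * f (AA 2 4) * f (AA 3 4))
      (f (AA 1 2) * f (AA 1 3) * f (AA 2 3) * f (AA 1 4) * f (AA 2 4) * f (AA 3 4)) := by
  have triple : ∀ i k j : ℕ, 1 ≤ i → i < k → k < j → j ≤ 4 →
      Commute (f (AA i k) * f (AA i j)) (f (AA k j)) ∧
        Commute (f (AA i k)) (f (AA i j) * f (AA k j)) := by
    intro i k j h1 h2 h3 h4
    apply commute_of_conj
    · have := hf _ ⟨1, Or.inl rfl, Or.inl ⟨i, k, j, h1, h2, h3, h4, rfl⟩⟩
      rw [map_mul, map_inv, mul_inv_eq_one] at this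
      simpa [mul_assoc] using this
    · have := hf _ ⟨1, Or.inl rfl, Or.inr (Or.inl ⟨i, k, j, h1, h2, h3, h4, rfl⟩)⟩
      rw [map_mul, map_inv, mul_inv_eq_one] at this
      simpa [mul_assoc] using this
  have disjoint : ∀ i m k j : ℕ, 1 ≤ i → i < m → m ≤ 4 → 1 ≤ k → k < j → j ≤ 4 →
      ((k < i ∧ m < j) ∨ m < k) → Commute (f (AA i m)) (f (AA k j)) := by
    intro i m k j h1 h2 h3 h4 h5 h6 h7
    have := hf _ ⟨1, Or.inl rfl, Or.inr (Or.inr (Or.inr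
      ⟨i, m, k, j, h1, h2, h3, h4, h5, h6, h7, rfl⟩))⟩
    have e : (f (AA i m))⁻¹ * f (AA k j) * f (AA i m) = f (AA k j) := by
      simpa [mul_inv_eq_one] using this
    rw [commute_iff_eq]
    conv_lhs => rw [← e]
    group
  have crossing : (f (AA 1 3))⁻¹ * f (AA 2 4) * f (AA 1 3) =
      f (AA 1 4) * f (AA 3 4) * (f (AA 1 4))⁻¹ * (f (AA 3 4))⁻¹ * f (AA 2 4) *
        (f (AA 1 4) * f (AA 3 4) * (f (AA 1 4))⁻¹ * (f (AA 3 4))⁻¹)⁻¹ := by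
    have := hf _ ⟨1, Or.inl rfl, Or.inr (Or.inr (Or.inl
      ⟨1, 2, 3, 4, by norm_num, by norm_num, by norm_num, by norm_num, by norm_num, rfl⟩))⟩
    rw [map_mul, map_inv, mul_inv_eq_one] at this
    simpa [cmP, mul_assoc] using this
  obtain ⟨t123, t123'⟩ := triple 1 2 3 (by norm_num) (by norm_num) (by norm_num) (by norm_num)
  obtain ⟨t124, t124'⟩ := triple 1 2 4 (by norm_num) (by norm_num) (by norm_num) (by norm_num)
  obtain ⟨t134, t134'⟩ := triple 1 3 4 (by norm_num) (by norm_num) (by norm_num) (by norm_num)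
  obtain ⟨t234, t234'⟩ := triple 2 3 4 (by norm_num) (by norm_num) (by norm_num) (by norm_num)
  have d12_34 := disjoint 1 2 3 4 (by norm_num) (by norm_num) (by norm_num) (by norm_num)
    (by norm_num) (by norm_num) (by norm_num)
  have d23_14 := disjoint 2 3 1 4 (by norm_num) (by norm_num) (by norm_num) (by norm_num)
    (by norm_num) (by norm_num) (by norm_num)
  generalize f (AA 1 2) = a12 at *
  generalize f (AA 1 3) = a13 at *
  generalize f (AA 2 3) = a23 at *
  generalize f (AA 1 4) = a14 at *
  generalize f (AA 2 4) = a24 at *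
  generalize f (AA 3 4) = a34 at *
  clear triple disjoint
  exact of_artin_commute t123 t123' t124 t124' t134 t134' t234 t234' d12_34 d23_14 (by
    rw [← mul_commutator_of_commute t134]
    have := conj_eq_conj_iff (a := a13) (b := a24)
      (x := (a14 * a34 * a14⁻¹ * a34⁻¹)⁻¹)
    simp only [inv_inv] at this
    exact this.1 crossing)

theorem of_cabled_conj {a b c d e f : H}
    (hba : a⁻¹ * b * a = b) (hca : a⁻¹ * c * a = b * c * b⁻¹) (hda : a⁻¹ * d * a = d)
    (hea : a⁻¹ * e * a = e) (hfa : a⁻¹ * f * a = e * f * e⁻¹) (hdb : b⁻¹ * d * b = d)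
    (heb : b⁻¹ * e * b = d * e * d⁻¹)
    (hfb : b⁻¹ * f * b = (e * d⁻¹)⁻¹ * f * (e * d⁻¹))
    (hdc : c⁻¹ * d * c = d) (hfc : c⁻¹ * f * c = d * f * d⁻¹)
    (hec : c * e * c⁻¹ =
      d⁻¹ * f * d * (e⁻¹ * f⁻¹ * e) * e * ((b * b)⁻¹ * c * (b * b) * c⁻¹)) :
    IsTwistSystem a (c⁻¹ * (a * b)) (e⁻¹ * b * d) (a * b) (a * b * d * f⁻¹) (a * b * d) := by
  have commute_of_conj_self : ∀ {x y : H}, x⁻¹ * y * x = y → Commute x y := fun {x y} h => by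
    rw [commute_iff_eq]
    conv_lhs => rw [← h]
    group
  have commute_of_conj_inv : ∀ {x y v : H}, x⁻¹ * y * x = v * y * v⁻¹ → Commute (x * v) y :=
    fun {x y v} h => by
      simpa using (conj_eq_conj_iff (a := x) (b := y) (x := v⁻¹)).1 (by simpa using h)
  have ab := commute_of_conj_self hba
  have ad := commute_of_conj_self hda
  have ae := commute_of_conj_self hea
  have bd := commute_of_conj_self hdb
  have cd := commute_of_conj_self hdc
  have abc := commute_of_conj_inv hca
  have aef := commute_of_conj_inv hfa
  have bde := commute_of_conj_inv heb
  have cdf := commute_of_conj_inv hfc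
  have wf : Commute (e⁻¹ * b * d) f := by
    have := conj_eq_conj_iff.1 hfb
    rwa [mul_inv_rev, inv_inv, ← mul_assoc, ← bde.inv_right.eq.symm, ← mul_assoc] at this
  have Ta : Commute (a * b) a := (Commute.refl a).mul_left ab.symm
  have Tb : Commute (a * b) b := ab.mul_left (Commute.refl b)
  have Da : Commute (a * b * d) a := Ta.mul_left ad.symm
  have Db : Commute (a * b * d) b := Tb.mul_left bd.symm
  have Dc : Commute (a * b * d) c := abc.mul_left cd.symm
  have Dd : Commute (a * b * d) d := (ad.mul_left bd).mul_left (Commute.refl d)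
  have De : Commute (a * b * d) e := by
    rw [mul_assoc]
    exact ae.mul_left bde
  have Df : Commute (a * b * d) f := by
    have : a * b * d = a * e * (e⁻¹ * b * d) := by group
    rw [this]
    exact aef.mul_left wf
  have Tc : Commute (a * b) (c⁻¹ * (a * b)) := abc.inv_right.mul_right (Commute.refl _)
  have DT : Commute (a * b * d) (a * b) := Da.mul_right Db
  have Dw : Commute (a * b * d) (e⁻¹ * b * d) := (De.inv_right.mul_right Db).mul_right Dd
  have fy : Commute f (c⁻¹ * (a * b)) := by
    have : c⁻¹ * (a * b) = (c * d)⁻¹ * (a * b * d) := by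
      rw [cd.eq, (ad.mul_left bd).eq]; group
    rw [this]
    exact cdf.symm.inv_right.mul_right Df.symm
  have h : TwistCommute a (c⁻¹ * (a * b)) (e⁻¹ * b * d) (a * b) (a * b * d * f⁻¹)
      (a * b * d) :=
    { Dz := Da
      Dy := Dc.inv_right.mul_right DT
      Dw := Dw
      DT := DT
      DU := (Commute.refl _).mul_right Df.inv_right
      Tz := Ta
      Ty := Tc
      zw := (ae.inv_right.mul_right ab).mul_right ad
      Uw := Dw.mul_left wf.symm.inv_left
      Uy := (Dc.inv_right.mul_right DT).mul_left fy.inv_left }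
  refine ⟨h, (c22_conj_inv_iff_pentagon h).1 ?_⟩
  have e1 : a * b * (c⁻¹ * (a * b))⁻¹ = c := by group
  have e2 : a⁻¹ * (a * b * d) * (e⁻¹ * b * d)⁻¹ = e := by group
  have e3 : (a * b)⁻¹ * (a * b * d) = d := by group
  have e4 : (a * b * d * f⁻¹)⁻¹ * (a * b * d) = f := by group
  rw [e1, e2, e3, e4, inv_mul_cancel_left, hec]

theorem of_hom_killing_Grels (f : FreeGroup CGen →* H) (hf : ∀ r ∈ Grels, f r = 1) :
    IsTwistSystem (f (g c11)) ((f (g c12))⁻¹ * (f (g c11) * f (g c21)))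
      ((f (g c22))⁻¹ * f (g c21) * f (g c31)) (f (g c11) * f (g c21))
      (f (g c11) * f (g c21) * f (g c31) * (f (g c13))⁻¹)
      (f (g c11) * f (g c21) * f (g c31)) := by
  have rel : ∀ u v : FreeGroup CGen, u * v⁻¹ ∈ Grels → f u = f v := fun u v h => by
    have := hf _ h
    rwa [map_mul, map_inv, mul_inv_eq_one] at this
  apply of_cabled_conj
  · have := rel _ _ (Or.inl ⟨1, Or.inl rfl, Or.inl rfl⟩)
    simpa [cjC] using this
  · have := rel _ _ (Or.inl ⟨1, Or.inl rfl, Or.inr (Or.inl rfl)⟩)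
    simpa [cjC] using this
  · have := rel _ _ (Or.inl ⟨1, Or.inl rfl, Or.inr (Or.inr (Or.inl rfl))⟩)
    simpa [cjC] using this
  · have := rel _ _ (Or.inl ⟨1, Or.inl rfl, Or.inr (Or.inr (Or.inr (Or.inl rfl)))⟩)
    simpa [cjC] using this
  · have := rel _ _ (Or.inl ⟨1, Or.inl rfl, Or.inr (Or.inr (Or.inr (Or.inr (Or.inl rfl))))⟩)
    simpa [cjC] using this
  · have := rel _ _ (Or.inl ⟨1, Or.inl rfl, Or.inr (Or.inr (Or.inr (Or.inr (Or.inr (Or.inl rfl)))))⟩)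
    simpa [cjC] using this
  · have := rel _ _ (Or.inl ⟨1, Or.inl rfl, Or.inr (Or.inr (Or.inr (Or.inr (Or.inr (Or.inr (Or.inl rfl))))))⟩)
    simpa [cjC] using this
  · have := rel _ _ (Or.inl ⟨1, Or.inl rfl, Or.inr (Or.inr (Or.inr (Or.inr (Or.inr (Or.inr (Or.inr (Or.inl rfl)))))))⟩)
    simpa [cjC] using this
  · have := rel _ _ (Or.inl ⟨1, Or.inl rfl, Or.inr (Or.inr (Or.inr (Or.inr (Or.inr (Or.inr (Or.inr (Or.inr (Or.inl rfl))))))))⟩)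
    simpa [cjC] using this
  · have := rel _ _ (Or.inl ⟨1, Or.inl rfl, Or.inr (Or.inr (Or.inr (Or.inr (Or.inr (Or.inr (Or.inr (Or.inr (Or.inr rfl))))))))⟩)
    simpa [cjC] using this
  · have := rel _ _ (Or.inr (Or.inl rfl))
    simpa only [cjC, cmC, map_mul, map_inv, map_pow, pow_two, inv_inv] using this

end IsTwistSystem

end Lift

/-- the group presented by the cabled generators and relations is
isomorphic to the Artin pure braid group `P_4`. -/
theorem cabled_presentation_iso_P4 :
    Nonempty (PresentedGroup Grels ≃* PresentedGroup P4rels) := by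
  have hP := IsTwistSystem.of_hom_killing_P4rels (PresentedGroup.mk P4rels)
    (fun _ hr => PresentedGroup.one_of_mem hr)
  have hG := IsTwistSystem.of_hom_killing_Grels (PresentedGroup.mk Grels)
    (fun _ hr => PresentedGroup.one_of_mem hr)
  obtain ⟨F, hF⟩ : ∃ F : PresentedGroup Grels →* PresentedGroup P4rels,
      ∀ c, F (PresentedGroup.mk Grels (g c)) = cabledWord _ _ _ _ _ _ c :=
    ⟨PresentedGroup.toGroup hP.lift_cabledWord_eq_one, fun _ => PresentedGroup.toGroup.of _⟩
  obtain ⟨E, hE⟩ : ∃ E : PresentedGroup P4rels →* PresentedGroup Grels,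
      ∀ i j, 1 ≤ i → i < j → j ≤ 4 →
        E (PresentedGroup.mk P4rels (AA i j)) = artinWord _ _ _ _ _ _ i j :=
    ⟨PresentedGroup.toGroup hG.lift_artinWord_eq_one,
      fun _ _ hi hij hj => lift_AA (artinWord _ _ _ _ _ _) hi hij hj⟩
  have h12 := hE 1 2 (by decide) (by decide) (by decide)
  have h13 := hE 1 3 (by decide) (by decide) (by decide)
  have h14 := hE 1 4 (by decide) (by decide) (by decide)
  have h23 := hE 2 3 (by decide) (by decide) (by decide)
  have h24 := hE 2 4 (by decide) (by decide) (by decide)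
  have h34 := hE 3 4 (by decide) (by decide) (by decide)
  simp only [artinWord] at h12 h13 h14 h23 h24 h34
  refine ⟨MonoidHom.toMulEquiv F E ?_ ?_⟩
  · ext c
    change E (F (PresentedGroup.mk Grels (g c))) = PresentedGroup.mk Grels (g c)
    rw [hF]
    cases c <;> simp only [cabledWord, map_mul, map_inv, h12, h13, h14, h23, h24, h34] <;> group
  · ext ⟨⟨i, j⟩, h⟩
    have of_eq : PresentedGroup.of (rels := P4rels) ⟨(i, j), h⟩ =
        PresentedGroup.mk P4rels (AA i j) := by rw [AA, dif_pos h]; rfl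
    change F (E (PresentedGroup.of _)) = PresentedGroup.of _
    rw [of_eq]
    have : (i = 1 ∧ j = 2) ∨ (i = 1 ∧ j = 3) ∨ (i = 1 ∧ j = 4) ∨ (i = 2 ∧ j = 3) ∨
      (i = 2 ∧ j = 4) ∨ (i = 3 ∧ j = 4) := by dsimp only at h; omega
    rcases this with ⟨rfl, rfl⟩ | ⟨rfl, rfl⟩ | ⟨rfl, rfl⟩ | ⟨rfl, rfl⟩ | ⟨rfl, rfl⟩ | ⟨rfl, rfl⟩ <;>
      simp only [h12, h13, h14, h23, h24, h34, map_mul, map_inv, hF, cabledWord] <;> group
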